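/- Let D ⊆ ℂⁿ be a domain and ψ an upper semi-continuous real-valued function on D. Let {D_j} be a sequence of open subsets of D with D_j ⊆ D_{j+1} for all j and ∪_j D_j = D, and let ψ_j be upper semi-continuous real-valued functions on D_j with ψ_j ≥ ψ_{j+1} on D_j for all j and lim_{j→∞} ψ_j(z) = ψ(z) for every z ∈ D. If every pair (D_j, ψ_j) is L²-optimal, then (D, ψ) is L²-optimal. -/

import Mathlib

open MeasureTheory Matrix Filter Topology
open scoped ENNReal ComplexOrder

noncomputable section

/-- The Wirtinger derivative `∂u/∂z̄ⱼ = (1/2)(∂u/∂xⱼ + i ∂u/∂yⱼ)` of `u : ℂⁿ → ℂ`. -/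
def dbarCoord {n : ℕ} (u : (Fin n → ℂ) → ℂ) (j : Fin n) (z : Fin n → ℂ) : ℂ :=
  (1 / 2 : ℂ) *
    (fderiv ℝ u z (Pi.single j 1) + Complex.I * fderiv ℝ u z (Pi.single j Complex.I))

/-- The Wirtinger derivative `∂u/∂zⱼ = (1/2)(∂u/∂xⱼ − i ∂u/∂yⱼ)` of `u : ℂⁿ → ℂ`. -/
def dzCoord {n : ℕ} (u : (Fin n → ℂ) → ℂ) (j : Fin n) (z : Fin n → ℂ) : ℂ :=
  (1 / 2 : ℂ) *
    (fderiv ℝ u z (Pi.single j 1) - Complex.I * fderiv ℝ u z (Pi.single j Complex.I))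

/-- `χ ∈ C_c^∞(D)`: a smooth compactly supported function with support inside `D`. -/
def IsTestFunOn {n : ℕ} (D : Set (Fin n → ℂ)) (χ : (Fin n → ℂ) → ℂ) : Prop :=
  ContDiff ℝ (⊤ : ℕ∞) χ ∧ HasCompactSupport χ ∧ tsupport χ ⊆ D

/-- The `(0,1)`-form `f = Σ fⱼ dz̄ⱼ` is `∂̄`-closed on `D` in the distributional sense. -/
def DbarClosedOn {n : ℕ} (D : Set (Fin n → ℂ)) (f : Fin n → (Fin n → ℂ) → ℂ) : Prop :=
  ∀ i j : Fin n, ∀ χ : (Fin n → ℂ) → ℂ, IsTestFunOn D χ →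
    ∫ z in D, (f i z * dbarCoord χ j z - f j z * dbarCoord χ i z) = 0

/-- `∂̄u = f` on `D` in the distributional sense. -/
def DbarEqOn {n : ℕ} (D : Set (Fin n → ℂ)) (u : (Fin n → ℂ) → ℂ)
    (f : Fin n → (Fin n → ℂ) → ℂ) : Prop :=
  ∀ j : Fin n, ∀ χ : (Fin n → ℂ) → ℂ, IsTestFunOn D χ →
    ∫ z in D, u z * dbarCoord χ j z = -∫ z in D, f j z * χ z

/-- `∫_D |u|² e^{−w} dλ` as an extended nonnegative real. -/
def eL2 {n : ℕ} (D : Set (Fin n → ℂ)) (w : (Fin n → ℂ) → ℝ) (u : (Fin n → ℂ) → ℂ) : ℝ≥0∞ :=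
  ∫⁻ z in D, ENNReal.ofReal (‖u z‖ ^ 2 * Real.exp (-w z))

/-- `∫_D Σⱼ|fⱼ|² e^{−w} dλ` for a `(0,1)`-form `f = Σ fⱼ dz̄ⱼ`. -/
def eL2form {n : ℕ} (D : Set (Fin n → ℂ)) (w : (Fin n → ℂ) → ℝ)
    (f : Fin n → (Fin n → ℂ) → ℂ) : ℝ≥0∞ :=
  ∫⁻ z in D, ENNReal.ofReal ((∑ j, ‖f j z‖ ^ 2) * Real.exp (-w z))

/-- The complex Hessian matrix `(∂²φ/∂zᵢ∂z̄ⱼ(z))` of `φ : ℂⁿ → ℝ`. -/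
def complexHessian {n : ℕ} (φ : (Fin n → ℂ) → ℝ) (z : Fin n → ℂ) :
    Matrix (Fin n) (Fin n) ℂ :=
  Matrix.of fun i j => dbarCoord (fun y => dzCoord (fun v => (φ v : ℂ)) i y) j z

/-- `φ : ℂⁿ → ℝ` is smooth and strictly plurisubharmonic (positive definite complex Hessian). -/
def SmoothStrictlyPSH {n : ℕ} (φ : (Fin n → ℂ) → ℝ) : Prop :=
  ContDiff ℝ (⊤ : ℕ∞) φ ∧ ∀ z, (complexHessian φ z).PosDef

/-- `⟨B_φ⁻¹ f, f⟩(z)`: the Hermitian form of the inverse complex Hessian of `φ`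
applied to the coefficient vector of `f`. -/
def Bform {n : ℕ} (φ : (Fin n → ℂ) → ℝ) (f : Fin n → (Fin n → ℂ) → ℂ) (z : Fin n → ℂ) : ℝ :=
  (star (fun i => f i z) ⬝ᵥ (complexHessian φ z)⁻¹.mulVec fun i => f i z).re

/-- The pair `(D, ψ)` is `L²`-optimal. -/
def L2OptimalPair {n : ℕ} (D : Set (Fin n → ℂ)) (ψ : (Fin n → ℂ) → ℝ) : Prop :=
  ∀ φ : (Fin n → ℂ) → ℝ, SmoothStrictlyPSH φ →
    ∀ f : Fin n → (Fin n → ℂ) → ℂ, (∀ j, Measurable (f j)) →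
      eL2form D (fun z => φ z + ψ z) f < ⊤ → DbarClosedOn D f →
      (∫⁻ z in D, ENNReal.ofReal (Bform φ f z * Real.exp (-(φ z + ψ z)))) < ⊤ →
      ∃ u : (Fin n → ℂ) → ℂ, Measurable u ∧ DbarEqOn D u f ∧
        eL2 D (fun z => φ z + ψ z) u ≤
          ∫⁻ z in D, ENNReal.ofReal (Bform φ f z * Real.exp (-(φ z + ψ z)))

/-- The domain `D` is `L²`-optimal. -/
def L2Optimal {n : ℕ} (D : Set (Fin n → ℂ)) : Prop :=
  L2OptimalPair D fun _ => 0

/-- `D` is an `L²`-domain of holomorphy. -/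
def L2DomainOfHolomorphy {n : ℕ} (D : Set (Fin n → ℂ)) : Prop :=
  ∀ U₁ U₂ : Set (Fin n → ℂ), IsOpen U₁ → IsOpen U₂ → U₁.Nonempty → U₁ ⊆ D ∩ U₂ →
    D ∩ U₂ ≠ U₂ → IsConnected U₂ →
    ∃ f : (Fin n → ℂ) → ℂ, DifferentiableOn ℂ f D ∧ eL2 D (fun _ => 0) f < ⊤ ∧
      ∀ F : (Fin n → ℂ) → ℂ, DifferentiableOn ℂ F U₂ → ¬Set.EqOn F f U₁

/-- Bounded sequences in a Hilbert space converge weakly along every ultrafilter. -/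
theorem exists_weak_limit_of_norm_le {H : Type*} [NormedAddCommGroup H] [InnerProductSpace ℂ H]
    [CompleteSpace H] {ι : Type*} (F : Ultrafilter ι) {v : ι → H} {R : ℝ}
    (hv : ∀ i, ‖v i‖ ≤ R) :
    ∃ w : H, ‖w‖ ≤ R ∧ ∀ x : H,
      Tendsto (fun i => inner ℂ (v i) x) F (𝓝 (inner ℂ w x)) := by
  let T : ι → WeakDual ℂ H :=
    fun i => StrongDual.toWeakDual (InnerProductSpace.toDual ℂ H (v i))
  have hT : ∀ i, T i ∈ WeakDual.toStrongDual ⁻¹' Metric.closedBall (0 : StrongDual ℂ H) R := by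
    intro i
    simpa [T] using hv i
  obtain ⟨ℓ, hℓ, hle⟩ := (WeakDual.isCompact_closedBall (0 : StrongDual ℂ H) R).ultrafilter_le_nhds
    (F.map T) (le_principal_iff.2 (mem_map.2 (univ_mem' hT)))
  have hlim : Tendsto T F (𝓝 ℓ) := hle
  refine ⟨(InnerProductSpace.toDual ℂ H).symm (WeakDual.toStrongDual ℓ), ?_, fun x => ?_⟩
  · simpa using hℓ
  · have h := ((WeakDual.eval_continuous x).tendsto ℓ).comp hlim
    have e : inner ℂ ((InnerProductSpace.toDual ℂ H).symm (WeakDual.toStrongDual ℓ)) x = ℓ x := by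
      rw [InnerProductSpace.toDual_symm_apply]; rfl
    rw [e]
    exact h

/-- The pairing of a bounded weakly convergent family with a norm convergent one converges. -/
theorem tendsto_inner_of_weak_of_strong {H : Type*} [NormedAddCommGroup H]
    [InnerProductSpace ℂ H] {ι : Type*} {F : Filter ι} {v g : ι → H} {w x : H} {R : ℝ}
    (hv : ∀ i, ‖v i‖ ≤ R) (hw : Tendsto (fun i => inner ℂ (v i) x) F (𝓝 (inner ℂ w x)))
    (hg : Tendsto g F (𝓝 x)) :
    Tendsto (fun i => inner ℂ (v i) (g i)) F (𝓝 (inner ℂ w x)) := by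
  have h0 : Tendsto (fun i => inner ℂ (v i) (g i - x)) F (𝓝 0) := by
    refine squeeze_zero_norm (a := fun i => R * ‖g i - x‖) (fun i => ?_) ?_
    · exact (norm_inner_le_norm _ _).trans
        (mul_le_mul_of_nonneg_right (hv i) (norm_nonneg _))
    · simpa using (tendsto_iff_norm_sub_tendsto_zero.1 hg).const_mul R
  simpa [inner_sub_right] using h0.add hw

theorem eLpNorm_two_sq {α : Type*} [MeasurableSpace α] {μ : Measure α} (f : α → ℂ) :
    eLpNorm f 2 μ ^ 2 = ∫⁻ a, ENNReal.ofReal (‖f a‖ ^ 2) ∂μ := by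
  have h : ∀ a, ENNReal.ofReal (‖f a‖ ^ 2) = ‖f a‖ₑ ^ (2 : ℝ) := fun a => by
    rw [ENNReal.ofReal_pow (norm_nonneg _), ofReal_norm]
    norm_cast
  simp_rw [h, eLpNorm_eq_lintegral_rpow_enorm_toReal two_ne_zero ENNReal.ofNat_ne_top]
  rw [← ENNReal.rpow_natCast, ← ENNReal.rpow_mul]
  simp

/-- Dominated convergence in `L²`. -/
theorem tendsto_toLp_two_of_dominated {α : Type*} [MeasurableSpace α] {μ : Measure α}
    {f : ℕ → α → ℂ} {g : α → ℂ} {b : α → ℝ} (hf : ∀ j, MemLp (f j) 2 μ) (hg : MemLp g 2 μ)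
    (hb : MemLp b 2 μ) (hfb : ∀ j a, ‖f j a‖ ≤ b a)
    (hlim : ∀ᵐ a ∂μ, Tendsto (fun j => f j a) atTop (𝓝 (g a))) :
    Tendsto (fun j => (hf j).toLp (f j)) atTop (𝓝 (hg.toLp g)) := by
  rw [Lp.tendsto_Lp_iff_tendsto_eLpNorm'']
  have hgb : ∀ᵐ a ∂μ, ‖g a‖ ≤ b a := by
    filter_upwards [hlim] with a ha
    exact le_of_tendsto ha.norm (Eventually.of_forall fun j => hfb j a)
  have hsq : Tendsto (fun j => eLpNorm (f j - g) 2 μ ^ 2) atTop (𝓝 0) := by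
    simp_rw [eLpNorm_two_sq]
    have hfin : ∫⁻ a, ENNReal.ofReal ((2 * b a) ^ 2) ∂μ ≠ ⊤ := by
      have hi : Integrable (fun a => (2 * b a) ^ 2) μ := (hb.const_mul 2).integrable_sq
      exact ((hasFiniteIntegral_iff_ofReal
        (Eventually.of_forall fun a => sq_nonneg _)).1 hi.2).ne
    have := tendsto_lintegral_of_dominated_convergence' (μ := μ)
      (F := fun j a => ENNReal.ofReal (‖(f j - g) a‖ ^ 2)) (f := fun _ => 0)
      (fun a => ENNReal.ofReal ((2 * b a) ^ 2))
      (fun j => (((hf j).1.sub hg.1).norm.aemeasurable.pow_const 2).ennreal_ofReal)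
      (fun j => by
        filter_upwards [hgb] with a ha
        refine ENNReal.ofReal_le_ofReal (pow_le_pow_left₀ (norm_nonneg _) ?_ 2)
        have := norm_sub_le (f j a) (g a)
        have := hfb j a
        simp only [Pi.sub_apply]
        linarith) hfin
      (by
        filter_upwards [hlim] with a ha
        have h := ENNReal.tendsto_ofReal
          (((tendsto_iff_norm_sub_tendsto_zero.1 ha).pow 2))
        simpa using h)
    simpa using this
  have h2 := (ENNReal.continuous_rpow_const (y := (1 / 2 : ℝ))).tendsto 0 |>.comp hsq
  have e : ∀ x : ℝ≥0∞, (x ^ 2) ^ (1 / 2 : ℝ) = x := fun x => by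
    rw [← ENNReal.rpow_natCast, ← ENNReal.rpow_mul]; simp
  simpa only [Function.comp_def, e, ENNReal.zero_rpow_of_pos one_half_pos] using h2

/-- A family bounded in varying weighted `L²` spaces has a weighted weak limit along an
ultrafilter, satisfying the same bound with respect to the limit weight. -/
theorem exists_weighted_weak_limit {α : Type*} [MeasurableSpace α] {μ : Measure α}
    {S : ℕ → Set α} (hS : ∀ j, MeasurableSet (S j)) (hSmono : Monotone S)
    {w : ℕ → α → ℝ} {w' : α → ℝ} (hw : ∀ j, AEMeasurable (w j) (μ.restrict (S j)))
    (hw' : AEMeasurable w' μ) {u : ℕ → α → ℂ} (hu : ∀ j, Measurable (u j))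
    {C : ℝ≥0∞} (hC : C ≠ ⊤)
    (hbound : ∀ j, ∫⁻ a in S j, ENNReal.ofReal (‖u j a‖ ^ 2 * Real.exp (-w j a)) ∂μ ≤ C)
    (F : Ultrafilter ℕ) (hF : (F : Filter ℕ) ≤ atTop) :
    ∃ U : α → ℂ, Measurable U ∧
      ∫⁻ a, ENNReal.ofReal (‖U a‖ ^ 2 * Real.exp (-w' a)) ∂μ ≤ C ∧
      ∀ (K : Set α) (g : α → ℂ) (k : ℕ) (B M : ℝ), MeasurableSet K → μ K ≠ ⊤ → K ⊆ S k →
        Measurable g → (∀ a, ‖g a‖ ≤ B) → (∀ j, k ≤ j → ∀ a ∈ K, w j a ≤ M) →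
        (∀ a ∈ K, Tendsto (fun j => w j a) atTop (𝓝 (w' a))) →
        Tendsto (fun j => ∫ a in K, u j a * g a ∂μ) F (𝓝 (∫ a in K, U a * g a ∂μ)) := by
  let v₀ : ℕ → α → ℂ := fun j => (S j).indicator fun a =>
    star (u j a) * (Real.exp (-w j a / 2) : ℂ)
  have hv₀m : ∀ j, AEMeasurable (v₀ j) μ := fun j => by
    refine (aemeasurable_indicator_iff (hS j)).2 ?_
    have := hw j
    have : Measurable fun a => star (u j a) := continuous_star.measurable.comp (hu j)
    fun_prop
  have hv₀ : ∀ j, eLpNorm (v₀ j) 2 μ ^ 2 ≤ C := fun j => by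
    rw [eLpNorm_two_sq]
    refine le_trans (le_of_eq ?_) (hbound j)
    rw [← lintegral_indicator (hS j)]
    congr 1 with a
    by_cases ha : a ∈ S j
    · simp only [v₀, Set.indicator_of_mem ha, norm_mul, norm_star, mul_pow, Complex.norm_real,
        Real.norm_eq_abs, Real.abs_exp]
      rw [← Real.exp_nat_mul]
      congr 3
      push_cast
      ring
    · simp [v₀, Set.indicator_of_notMem ha]
  have hv₀fin : ∀ j, eLpNorm (v₀ j) 2 μ ≠ ⊤ := fun j h => by
    have := hv₀ j
    rw [h] at this
    exact hC (top_le_iff.1 (by simpa using this))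
  have hmem : ∀ j, MemLp (v₀ j) 2 μ := fun j =>
    ⟨(hv₀m j).aestronglyMeasurable, (hv₀fin j).lt_top⟩
  let v : ℕ → Lp ℂ 2 μ := fun j => (hmem j).toLp (v₀ j)
  have hvR : ∀ j, ‖v j‖ ≤ Real.sqrt C.toReal := fun j => by
    rw [Lp.norm_toLp]
    refine Real.le_sqrt_of_sq_le ?_
    rw [← ENNReal.toReal_pow]
    exact ENNReal.toReal_mono hC (hv₀ j)
  obtain ⟨V, hVR, hV⟩ := exists_weak_limit_of_norm_le F hvR
  have hVm : Measurable V := (Lp.stronglyMeasurable V).measurable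
  refine ⟨fun a => star (V a) * (Real.exp (hw'.mk w' a / 2) : ℂ), ?_, ?_, ?_⟩
  · have := hw'.measurable_mk
    have : Measurable fun a => star (V a) := continuous_star.measurable.comp hVm
    fun_prop
  · have h1 : ∫⁻ a, ENNReal.ofReal (‖star (V a) * (Real.exp (hw'.mk w' a / 2) : ℂ)‖ ^ 2 *
        Real.exp (-w' a)) ∂μ = eLpNorm V 2 μ ^ 2 := by
      rw [eLpNorm_two_sq]
      refine lintegral_congr_ae ?_
      filter_upwards [hw'.ae_eq_mk] with a ha
      rw [← ha, norm_mul, norm_star, mul_pow, Complex.norm_real, Real.norm_eq_abs,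
        Real.abs_exp, ← Real.exp_nat_mul, mul_assoc, ← Real.exp_add]
      congr 1
      have : ((2 : ℕ) : ℝ) * (w' a / 2) + -w' a = 0 := by push_cast; ring
      rw [this, Real.exp_zero, mul_one]
    rw [h1, ← Lp.enorm_def, ← ofReal_norm, ← ENNReal.ofReal_pow (norm_nonneg _)]
    refine ENNReal.ofReal_le_of_le_toReal ?_
    calc ‖V‖ ^ 2 ≤ Real.sqrt C.toReal ^ 2 := pow_le_pow_left₀ (norm_nonneg _) hVR 2
      _ = C.toReal := Real.sq_sqrt ENNReal.toReal_nonneg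
  · intro K g k B M hK hμK hKS hgm hgB hwM hwlim
    let G₀ : ℕ → α → ℂ := fun j => K.indicator fun a => g a * (Real.exp (w (max j k) a / 2) : ℂ)
    let G : α → ℂ := K.indicator fun a => g a * (Real.exp (w' a / 2) : ℂ)
    let b : α → ℝ := K.indicator fun _ => B * Real.exp (M / 2)
    have hb : MemLp b 2 μ := memLp_indicator_const 2 hK _ (Or.inr hμK)
    have hGm : ∀ j, AEMeasurable (G₀ j) μ := fun j => by
      refine (aemeasurable_indicator_iff hK).2 ?_
      have := (hw (max j k)).mono_set (hKS.trans (hSmono (le_max_right j k)))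
      fun_prop
    have hGb : ∀ j a, ‖G₀ j a‖ ≤ b a := fun j a => by
      by_cases ha : a ∈ K
      · simp only [G₀, b, Set.indicator_of_mem ha, norm_mul, Complex.norm_real,
          Real.norm_eq_abs, Real.abs_exp]
        have := hwM _ (le_max_right j k) a ha
        have := (norm_nonneg _).trans (hgB a)
        gcongr
        exact hgB a
      · simp [G₀, b, Set.indicator_of_notMem ha]
    have hGlim : ∀ a, Tendsto (fun j => G₀ j a) atTop (𝓝 (G a)) := fun a => by
      by_cases ha : a ∈ K
      · simp only [G₀, G, Set.indicator_of_mem ha]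
        have hmax : Tendsto (fun j : ℕ => max j k) atTop atTop :=
          tendsto_atTop_mono (fun j => le_max_left j k) tendsto_id
        have h1 := (hwlim a ha).comp hmax
        have hc : Continuous fun t : ℝ => g a * (Real.exp (t / 2) : ℂ) := by fun_prop
        exact (hc.tendsto _).comp h1
      · simp [G₀, G, Set.indicator_of_notMem ha]
    have hG₀mem : ∀ j, MemLp (G₀ j) 2 μ := fun j =>
      hb.mono' (hGm j).aestronglyMeasurable (Eventually.of_forall (hGb j))
    have hGmem : MemLp G 2 μ :=
      hb.mono' (aemeasurable_of_tendsto_metrizable_ae' hGm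
        (Eventually.of_forall hGlim)).aestronglyMeasurable
        (Eventually.of_forall fun a =>
          le_of_tendsto (hGlim a).norm (Eventually.of_forall fun j => hGb j a))
    have hstrong := tendsto_toLp_two_of_dominated hG₀mem hGmem hb hGb
      (Eventually.of_forall hGlim)
    have key := tendsto_inner_of_weak_of_strong hvR (hV (hGmem.toLp G)) (hstrong.mono_left hF)
    have elim : inner ℂ V (hGmem.toLp G) =
        ∫ a in K, star (V a) * (Real.exp (hw'.mk w' a / 2) : ℂ) * g a ∂μ := by
      rw [L2.inner_def, ← integral_indicator hK]
      refine integral_congr_ae ?_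
      filter_upwards [hw'.ae_eq_mk, hGmem.coeFn_toLp] with a ha hGa
      rw [hGa, RCLike.inner_apply]
      by_cases haK : a ∈ K
      · simp only [G, Set.indicator_of_mem haK, Complex.star_def, ← ha]
        ring
      · simp [G, Set.indicator_of_notMem haK]
    rw [elim] at key
    refine key.congr' ?_
    filter_upwards [hF (eventually_ge_atTop k)] with j hj
    rw [L2.inner_def, ← integral_indicator hK]
    refine integral_congr_ae ?_
    filter_upwards [(hmem j).coeFn_toLp, (hG₀mem j).coeFn_toLp] with a hva hGa
    rw [hva, hGa, RCLike.inner_apply]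
    by_cases haK : a ∈ K
    · have haS : a ∈ S j := hSmono hj (hKS haK)
      simp only [G₀, v₀, Set.indicator_of_mem haK, Set.indicator_of_mem haS, max_eq_left hj,
        map_mul, Complex.conj_ofReal, Complex.star_def, Complex.conj_conj]
      have : (Real.exp (w j a / 2) : ℂ) * (Real.exp (-w j a / 2) : ℂ) = 1 := by
        rw [← Complex.ofReal_mul, ← Real.exp_add, neg_div, add_neg_cancel, Real.exp_zero,
          Complex.ofReal_one]
      linear_combination (g a * u j a) * this
    · simp [G₀, Set.indicator_of_notMem haK]

theorem UpperSemicontinuousOn.aemeasurable_restrict {α : Type*} [TopologicalSpace α]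
    [MeasurableSpace α] [BorelSpace α] {μ : Measure α} {s : Set α} (hs : MeasurableSet s)
    {f : α → ℝ} (hf : UpperSemicontinuousOn f s) : AEMeasurable f (μ.restrict s) :=
  aemeasurable_restrict_of_measurable_subtype hs
    (upperSemicontinuousOn_iff_restrict.2 hf).measurable

theorem dbarCoord_eq_zero_of_notMem_tsupport {n : ℕ} {χ : (Fin n → ℂ) → ℂ} {z : Fin n → ℂ}
    (hz : z ∉ tsupport χ) (j : Fin n) : dbarCoord χ j z = 0 := by
  simp [dbarCoord, fderiv_of_notMem_tsupport ℝ hz]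

theorem IsTestFunOn.continuous_dbarCoord {n : ℕ} {D : Set (Fin n → ℂ)} {χ : (Fin n → ℂ) → ℂ}
    (h : IsTestFunOn D χ) (j : Fin n) : Continuous (dbarCoord χ j) := by
  have := h.1.continuous_fderiv (by simp)
  unfold dbarCoord
  fun_prop

theorem IsTestFunOn.exists_norm_dbarCoord_le {n : ℕ} {D : Set (Fin n → ℂ)}
    {χ : (Fin n → ℂ) → ℂ} (h : IsTestFunOn D χ) (j : Fin n) :
    ∃ B, ∀ z, ‖dbarCoord χ j z‖ ≤ B :=
  (HasCompactSupport.intro h.2.1 fun _ hz =>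
    dbarCoord_eq_zero_of_notMem_tsupport hz j).exists_bound_of_continuous
      (h.continuous_dbarCoord j)

theorem Bform_nonneg {n : ℕ} {φ : (Fin n → ℂ) → ℝ} (hφ : SmoothStrictlyPSH φ)
    (f : Fin n → (Fin n → ℂ) → ℂ) (z : Fin n → ℂ) : 0 ≤ Bform φ f z :=
  (Complex.le_def.1 ((hφ.2 z).inv.posSemidef.dotProduct_mulVec_nonneg fun i => f i z)).1

/-- Integrals of functions vanishing off the support of a test function do not depend on the
domain containing that support. -/
theorem setIntegral_eq_tsupport {n : ℕ} {D : Set (Fin n → ℂ)} (hD : MeasurableSet D)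
    {χ h : (Fin n → ℂ) → ℂ} (hχ : tsupport χ ⊆ D) (hh : ∀ z ∉ tsupport χ, h z = 0) :
    ∫ z in D, h z = ∫ z in tsupport χ, h z :=
  setIntegral_eq_of_subset_of_forall_sdiff_eq_zero hD hχ fun z hz => hh z hz.2

theorem DbarClosedOn.mono {n : ℕ} {D E : Set (Fin n → ℂ)} (hD : MeasurableSet D)
    (hE : MeasurableSet E) (hED : E ⊆ D) {f : Fin n → (Fin n → ℂ) → ℂ}
    (hf : DbarClosedOn D f) : DbarClosedOn E f := by
  intro i j χ hχ
  have h0 : ∀ z ∉ tsupport χ, f i z * dbarCoord χ j z - f j z * dbarCoord χ i z = 0 :=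
    fun z hz => by simp [dbarCoord_eq_zero_of_notMem_tsupport hz]
  rw [setIntegral_eq_tsupport hE hχ.2.2 h0, ← setIntegral_eq_tsupport hD (hχ.2.2.trans hED) h0]
  exact hf i j χ ⟨hχ.1, hχ.2.1, hχ.2.2.trans hED⟩

/-- Shrinking the domain and increasing the weight decreases weighted integrals. -/
theorem lintegral_mul_exp_neg_mono {α : Type*} [MeasurableSpace α] {μ : Measure α}
    {D E : Set α} (hE : MeasurableSet E) (hED : E ⊆ D) {F w₁ w₂ : α → ℝ} (hF : ∀ a, 0 ≤ F a)
    (hw : ∀ a ∈ E, w₁ a ≤ w₂ a) :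
    ∫⁻ a in E, ENNReal.ofReal (F a * Real.exp (-w₂ a)) ∂μ ≤
      ∫⁻ a in D, ENNReal.ofReal (F a * Real.exp (-w₁ a)) ∂μ := by
  refine (setLIntegral_mono' hE fun a ha => ?_).trans (lintegral_mono_set hED)
  refine ENNReal.ofReal_le_ofReal (mul_le_mul_of_nonneg_left ?_ (hF a))
  exact Real.exp_le_exp.2 (neg_le_neg (hw a ha))

/-- Proposition 4.2: if `D = ∪ⱼ Dⱼ` with `Dⱼ ⊆ D_{j+1}` open, and
`ψⱼ` are upper semicontinuous on `Dⱼ`, decreasing in `j` and converging pointwise to the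
upper semicontinuous `ψ` on `D`, and each pair `(Dⱼ, ψⱼ)` is `L²`-optimal, then `(D, ψ)`
is `L²`-optimal. -/
theorem l2OptimalPair_of_exhaustion {n : ℕ} (D : Set (Fin n → ℂ))
    (hOpen : IsOpen D) (hConn : IsConnected D) (hne : D.Nonempty)
    (ψ : (Fin n → ℂ) → ℝ) (hψ : UpperSemicontinuousOn ψ D)
    (Dj : ℕ → Set (Fin n → ℂ)) (hDjOpen : ∀ j, IsOpen (Dj j)) (hDjsub : ∀ j, Dj j ⊆ D)
    (hmono : ∀ j, Dj j ⊆ Dj (j + 1)) (hunion : ⋃ j, Dj j = D)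
    (ψj : ℕ → (Fin n → ℂ) → ℝ) (hψj : ∀ j, UpperSemicontinuousOn (ψj j) (Dj j))
    (hdec : ∀ j, ∀ z ∈ Dj j, ψj (j + 1) z ≤ ψj j z)
    (hlim : ∀ z ∈ D, Tendsto (fun j => ψj j z) atTop (𝓝 (ψ z)))
    (hopt : ∀ j, L2OptimalPair (Dj j) (ψj j)) :
    L2OptimalPair D ψ := by
  intro φ hφ f hfm hfL2 hfclosed hfB
  have hDjmono : Monotone Dj := monotone_nat_of_le_succ hmono
  have hD := hOpen.measurableSet
  have hDj := fun j => (hDjOpen j).measurableSet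
  have hanti : ∀ k, ∀ z ∈ Dj k, ∀ j, k ≤ j → ψj j z ≤ ψj k z := by
    intro k z hz j hj
    induction j, hj using Nat.le_induction with
    | base => exact le_rfl
    | succ j hj ih => exact (hdec j z (hDjmono hj hz)).trans ih
  have hle : ∀ j, ∀ z ∈ Dj j, φ z + ψ z ≤ φ z + ψj j z := fun j z hz =>
    add_le_add_right (le_of_tendsto (hlim z (hDjsub j hz))
      ((eventually_ge_atTop j).mono (hanti j z hz))) _
  have hBle := fun j => lintegral_mul_exp_neg_mono (μ := volume) (hDj j) (hDjsub j)
    (Bform_nonneg hφ f) (hle j)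
  have hsol := fun j => hopt j φ hφ f hfm
    ((lintegral_mul_exp_neg_mono (hDj j) (hDjsub j) (fun z => by positivity)
      (hle j)).trans_lt hfL2)
    (hfclosed.mono hD (hDj j) (hDjsub j)) ((hBle j).trans_lt hfB)
  choose u hum hueq hule using hsol
  have hφm : Measurable φ := hφ.1.continuous.measurable
  obtain ⟨U, hUm, hUle, hU⟩ := exists_weighted_weak_limit (μ := volume.restrict D)
    hDj hDjmono (w := fun j z => φ z + ψj j z) (w' := fun z => φ z + ψ z)
    (fun j => by
      rw [Measure.restrict_restrict (hDj j), Set.inter_eq_left.2 (hDjsub j)]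
      exact hφm.aemeasurable.add ((hψj j).aemeasurable_restrict (hDj j)))
    (hφm.aemeasurable.add (hψ.aemeasurable_restrict hD)) hum hfB.ne
    (fun j => by
      rw [Measure.restrict_restrict (hDj j), Set.inter_eq_left.2 (hDjsub j)]
      exact (hule j).trans (hBle j))
    (hyperfilter ℕ) Nat.hyperfilter_le_atTop
  refine ⟨U, hUm, fun i χ hχ => ?_, hUle⟩
  have hKc : IsCompact (tsupport χ) := hχ.2.1
  obtain ⟨k, hk⟩ := hKc.elim_directed_cover Dj hDjOpen (hunion ▸ hχ.2.2) hDjmono.directed_le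
  obtain ⟨B, hB⟩ := hχ.exists_norm_dbarCoord_le i
  obtain ⟨M₁, hM₁⟩ := hKc.bddAbove_image hφ.1.continuous.continuousOn
  obtain ⟨M₂, hM₂⟩ := ((hψj k).mono hk).bddAbove_of_isCompact hKc
  have hKm : MeasurableSet (tsupport χ) := (isClosed_tsupport χ).measurableSet
  have hconv := hU (tsupport χ) (dbarCoord χ i) k B (M₁ + M₂) hKm
    ((Measure.restrict_apply_le D _).trans_lt hKc.measure_lt_top).ne hk
    (hχ.continuous_dbarCoord i).measurable hB
    (fun j hj z hz => add_le_add (hM₁ ⟨z, hz, rfl⟩)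
      ((hanti k z (hk hz) j hj).trans (hM₂ ⟨z, hz, rfl⟩)))
    (fun z hz => (hlim z (hχ.2.2 hz)).const_add (φ z))
  rw [Measure.restrict_restrict hKm, Set.inter_eq_left.2 hχ.2.2] at hconv
  have hu0 : ∀ v : (Fin n → ℂ) → ℂ, ∀ z ∉ tsupport χ, v z * dbarCoord χ i z = 0 :=
    fun v z hz => by rw [dbarCoord_eq_zero_of_notMem_tsupport hz, mul_zero]
  have hf0 : ∀ z ∉ tsupport χ, f i z * χ z = 0 := fun z hz => by
    rw [image_eq_zero_of_notMem_tsupport hz, mul_zero]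
  rw [setIntegral_eq_tsupport hD hχ.2.2 (hu0 U), setIntegral_eq_tsupport hD hχ.2.2 hf0]
  refine tendsto_nhds_unique hconv (tendsto_const_nhds.congr' ?_)
  filter_upwards [Nat.hyperfilter_le_atTop (eventually_ge_atTop k)] with j hj
  have hKj := hk.trans (hDjmono hj)
  rw [← setIntegral_eq_tsupport (hDj j) hKj (hu0 (u j)),
    ← setIntegral_eq_tsupport (hDj j) hKj hf0]
  exact (hueq j i χ ⟨hχ.1, hχ.2.1, hKj⟩).symm

end
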